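/- arXiv:2507.22316 — 6 statements merged into one kernel-verified Lean document; each statement's English description precedes it below -/
import Mathlib

section
/- Let E, F be finite-dimensional real inner product spaces, let g : E → F^m be continuously differentiable with components g_i : E → F, and let ε > 0. Then the smoothed regularizer r_ε(y) = Σ_{i=1}^m H_ε(g_i(y)) is differentiable on E with gradient ∇r_ε(y) = Σ_{i : ‖g_i(y)‖ ≤ ε} (Dg_i(y))^* (g_i(y)/ε) + Σ_{i : ‖g_i(y)‖ > ε} (Dg_i(y))^* (g_i(y)/‖g_i(y)‖), where Dg_i(y) : E → F is the Fréchet derivative of g_i at y and (Dg_i(y))^* its adjoint. -/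
/-- The smoothed norm `H_ε(y) = ‖y‖²/(2ε)` if `‖y‖ ≤ ε`, and `‖y‖ - ε/2` otherwise. -/
noncomputable def smoothedNorm {F : Type*} [NormedAddCommGroup F] (ε : ℝ) (y : F) : ℝ :=
  if ‖y‖ ≤ ε then ‖y‖ ^ 2 / (2 * ε) else ‖y‖ - ε / 2

theorem abs_smoothedNorm_sub_sq_le {F : Type*} [NormedAddCommGroup F] {ε : ℝ} (hε : 0 < ε)
    {x : F} (hx : ‖x‖ ≤ ε) (y : F) :
    |smoothedNorm ε y - ‖y‖ ^ 2 / (2 * ε)| ≤ (2 * ε)⁻¹ * ‖y - x‖ ^ 2 := by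
  unfold smoothedNorm
  split_ifs with hy
  · simp only [sub_self, abs_zero]
    positivity
  · have h : ‖y‖ - ε / 2 - ‖y‖ ^ 2 / (2 * ε) = -((2 * ε)⁻¹ * (‖y‖ - ε) ^ 2) := by
      field_simp
      ring
    have hxy : ‖y‖ - ε ≤ ‖y - x‖ := by linarith [norm_sub_norm_le y x]
    rw [h, abs_neg, abs_of_nonneg (by positivity)]
    gcongr
    linarith

theorem hasFDerivAt_norm_of_ne_zero {F : Type*} [NormedAddCommGroup F] [InnerProductSpace ℝ F]
    {x : F} (hx : x ≠ 0) :
    HasFDerivAt (fun y : F => ‖y‖) (innerSL ℝ (‖x‖⁻¹ • x)) x := by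
  have h := (hasStrictFDerivAt_norm_sq x).hasFDerivAt.sqrt (pow_ne_zero 2 (norm_ne_zero_iff.2 hx))
  simp only [Real.sqrt_sq (norm_nonneg _)] at h
  refine h.congr_fderiv ?_
  ext v
  have hx' : ‖x‖ ≠ 0 := norm_ne_zero_iff.2 hx
  simp
  field_simp

theorem hasFDerivAt_smoothedNorm {F : Type*} [NormedAddCommGroup F] [InnerProductSpace ℝ F]
    {ε : ℝ} (hε : 0 < ε) (x : F) :
    HasFDerivAt (smoothedNorm ε : F → ℝ)
      (innerSL ℝ (if ‖x‖ ≤ ε then ε⁻¹ • x else ‖x‖⁻¹ • x)) x := by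
  split_ifs with hx
  · have hsq : HasFDerivAt (fun y : F => ‖y‖ ^ 2 / (2 * ε)) (innerSL ℝ (ε⁻¹ • x)) x := by
      simp only [div_eq_mul_inv]
      refine ((hasStrictFDerivAt_norm_sq x).hasFDerivAt.mul_const (2 * ε)⁻¹).congr_fderiv ?_
      ext v
      simp
      field_simp
    have hdiff : HasFDerivAt (fun y : F => smoothedNorm ε y - ‖y‖ ^ 2 / (2 * ε))
        (0 : F →L[ℝ] ℝ) x := by
      refine Asymptotics.IsBigO.hasFDerivAt (n := 2) ?_ one_lt_two
      refine Asymptotics.IsBigO.of_bound (2 * ε)⁻¹ (Filter.Eventually.of_forall fun y => ?_)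
      simpa using abs_smoothedNorm_sub_sq_le hε hx y
    simpa using hdiff.fun_add hsq
  · have hx0 : x ≠ 0 := by
      rintro rfl
      exact hx (by simpa using hε.le)
    refine ((hasFDerivAt_norm_of_ne_zero hx0).sub_const (ε / 2)).congr_of_eventuallyEq ?_
    filter_upwards [continuous_norm.continuousAt.eventually_const_lt (not_le.1 hx)] with y hy
    simp [smoothedNorm, not_le.2 hy]

theorem HasFDerivAt.hasGradientAt_comp_innerSL {E F : Type*}
    [NormedAddCommGroup E] [InnerProductSpace ℝ E] [CompleteSpace E]
    [NormedAddCommGroup F] [InnerProductSpace ℝ F] [CompleteSpace F]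
    {φ : F → ℝ} {f : E → F} {f' : E →L[ℝ] F} {y : E} {v : F}
    (hφ : HasFDerivAt φ (innerSL ℝ v) (f y)) (hf : HasFDerivAt f f' y) :
    HasGradientAt (fun z => φ (f z)) (ContinuousLinearMap.adjoint f' v) y := by
  rw [hasGradientAt_iff_hasFDerivAt]
  refine (hφ.comp y hf).congr_fderiv ?_
  ext w
  simp [ContinuousLinearMap.adjoint_inner_left]

theorem gradient_smoothed_regularizer
    {E F : Type*} [NormedAddCommGroup E] [InnerProductSpace ℝ E] [FiniteDimensional ℝ E]
    [NormedAddCommGroup F] [InnerProductSpace ℝ F] [FiniteDimensional ℝ F]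
    {m : ℕ} (g : Fin m → E → F) (hg : ∀ i, ContDiff ℝ 1 (g i))
    {ε : ℝ} (hε : 0 < ε) :
    Differentiable ℝ (fun y : E => ∑ i, smoothedNorm ε (g i y)) ∧
    ∀ y : E,
      gradient (fun y : E => ∑ i, smoothedNorm ε (g i y)) y =
        ∑ i, ContinuousLinearMap.adjoint (fderiv ℝ (g i) y)
          (if ‖g i y‖ ≤ ε then ε⁻¹ • g i y else ‖g i y‖⁻¹ • g i y) := by
  have key (y : E) : HasGradientAt (fun y : E => ∑ i, smoothedNorm ε (g i y))
      (∑ i, ContinuousLinearMap.adjoint (fderiv ℝ (g i) y)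
        (if ‖g i y‖ ≤ ε then ε⁻¹ • g i y else ‖g i y‖⁻¹ • g i y)) y := by
    rw [hasGradientAt_iff_hasFDerivAt, map_sum]
    exact HasFDerivAt.fun_sum fun i _ =>
      ((hasFDerivAt_smoothedNorm hε (g i y)).hasGradientAt_comp_innerSL
        ((hg i).differentiable one_ne_zero y).hasFDerivAt).hasFDerivAt
  exact ⟨fun y => (key y).differentiableAt, fun y => (key y).gradient⟩
end

section
/- Let E, F be finite-dimensional real inner product spaces and let g : E → F^m be continuously differentiable with components g_i, such that the derivative map y ↦ Dg(y) is L_g-Lipschitz in operator norm and ‖Dg(y)‖ ≤ M for all y ∈ E. Then for every ε > 0 the gradient of the smoothed regularizer r_ε(y) = Σ_{i=1}^m H_ε(g_i(y)) is Lipschitz continuous with Lipschitz constant √m·L_g + M²/ε; that is, ‖∇r_ε(y) − ∇r_ε(y')‖ ≤ (√m·L_g + M²/ε)‖y − y'‖ for all y, y' ∈ E. -/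
open scoped RealInnerProductSpace

/-- A function with a Lipschitz selection of subgradients is differentiable, with that selection
as its gradient. -/
lemma hasFDerivAt_of_lipschitz_subgradient {V : Type*} [NormedAddCommGroup V]
    [InnerProductSpace ℝ V] {f : V → ℝ} {p : V → V} {C : ℝ}
    (hsub : ∀ u v, f u + ⟪p u, v - u⟫ ≤ f v)
    (hp : ∀ u v, ‖p u - p v‖ ≤ C * ‖u - v‖) (u : V) :
    HasFDerivAt f (innerSL ℝ (p u)) u := by
  rw [hasFDerivAt_iff_isLittleO]
  refine Asymptotics.IsBigO.trans_isLittleO (g := fun v => ‖v - u‖ ^ 2)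
    (Asymptotics.IsBigO.of_bound C (Filter.Eventually.of_forall fun v => ?_)) ?_
  · have h₁ := hsub u v
    have h₂ := hsub v u
    have h₃ : ⟪p v - p u, v - u⟫ ≤ C * ‖v - u‖ ^ 2 := by
      calc _ ≤ ‖p v - p u‖ * ‖v - u‖ := real_inner_le_norm _ _
        _ ≤ C * ‖v - u‖ * ‖v - u‖ := by gcongr; exact hp v u
        _ = _ := by ring
    rw [← neg_sub v u, inner_neg_right] at h₂
    rw [inner_sub_left] at h₃
    rw [innerSL_apply_apply, Real.norm_of_nonneg (by linarith), Real.norm_of_nonneg (by positivity)]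
    linarith
  · have h : Filter.Tendsto (fun v => v - u) (nhds u) (nhds 0) := by
      exact (continuous_id.sub continuous_const).tendsto' u (0 : V) (by simp)
    exact (Asymptotics.isLittleO_norm_pow_id one_lt_two).comp_tendsto h

/-- The gradient `y / max ε ‖y‖` of the smoothed norm. -/
noncomputable def smoothedNormGradient {F : Type*} [NormedAddCommGroup F] [NormedSpace ℝ F]
    (ε : ℝ) (y : F) : F :=
  (max ε ‖y‖)⁻¹ • y

section SmoothedNorm

variable {F : Type*} [NormedAddCommGroup F] [InnerProductSpace ℝ F] {ε : ℝ}

lemma norm_smoothedNormGradient_le_one (hε : 0 < ε) (y : F) :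
    ‖smoothedNormGradient ε y‖ ≤ 1 := by
  have h : 0 < max ε ‖y‖ := lt_max_of_lt_left hε
  rw [smoothedNormGradient, norm_smul, norm_inv, Real.norm_of_nonneg h.le, inv_mul_le_iff₀ h,
    mul_one]
  exact le_max_right _ _

lemma inner_sub_smoothedNormGradient_nonpos (hε : 0 < ε) (y : F) {q : F} (hq : ‖q‖ ≤ 1) :
    ⟪y - ε • smoothedNormGradient ε y, q - smoothedNormGradient ε y⟫ ≤ 0 := by
  rcases le_or_gt ‖y‖ ε with h | h
  · simp [smoothedNormGradient, max_eq_left h, smul_smul, hε.ne']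
  · have hy : 0 < ‖y‖ := hε.trans h
    have hqy : ⟪y, q⟫ ≤ ‖y‖ := (real_inner_le_norm y q).trans (by nlinarith)
    rw [smoothedNormGradient, max_eq_right h.le]
    have e : y - ε • ‖y‖⁻¹ • y = (1 - ε * ‖y‖⁻¹) • y := by
      rw [sub_smul, one_smul, mul_smul]
    rw [e, real_inner_smul_left, inner_sub_right, real_inner_smul_right,
      real_inner_self_eq_norm_sq]
    refine mul_nonpos_of_nonneg_of_nonpos ?_ ?_
    · rw [sub_nonneg, mul_inv_le_iff₀ hy, one_mul]
      exact h.le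
    · rw [pow_two, inv_mul_cancel_left₀ hy.ne']
      linarith

lemma norm_smoothedNormGradient_sub_le (hε : 0 < ε) (y z : F) :
    ‖smoothedNormGradient ε y - smoothedNormGradient ε z‖ ≤ ε⁻¹ * ‖y - z‖ := by
  have h₁ := inner_sub_smoothedNormGradient_nonpos hε y (norm_smoothedNormGradient_le_one hε z)
  have h₂ := inner_sub_smoothedNormGradient_nonpos hε z (norm_smoothedNormGradient_le_one hε y)
  set p := smoothedNormGradient ε y
  set q := smoothedNormGradient ε z
  have h₃ : ε * ‖p - q‖ ^ 2 ≤ ⟪y - z, p - q⟫ := by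
    rw [← real_inner_self_eq_norm_sq]
    simp only [inner_sub_left, inner_sub_right, real_inner_smul_left] at h₁ h₂ ⊢
    linarith
  have h₄ := h₃.trans (real_inner_le_norm _ _)
  rw [le_inv_mul_iff₀ hε]
  rcases (norm_nonneg (p - q)).eq_or_lt with h | h
  · rw [← h, mul_zero]
    positivity
  · exact le_of_mul_le_mul_right (by linarith) h

lemma smoothedNorm_eq (hε : 0 < ε) (y : F) :
    smoothedNorm ε y =
      ⟪smoothedNormGradient ε y, y⟫ - ε / 2 * ‖smoothedNormGradient ε y‖ ^ 2 := by
  rw [smoothedNorm, smoothedNormGradient, real_inner_smul_left, real_inner_self_eq_norm_sq,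
    norm_smul, norm_inv, Real.norm_of_nonneg (lt_max_of_lt_left hε).le]
  split_ifs with h
  · rw [max_eq_left h]
    field_simp
    ring
  · have hy : 0 < ‖y‖ := hε.trans (not_le.mp h)
    rw [max_eq_right (not_le.mp h).le]
    field_simp

lemma inner_sub_le_smoothedNorm (hε : 0 < ε) (y : F) {q : F} (hq : ‖q‖ ≤ 1) :
    ⟪q, y⟫ - ε / 2 * ‖q‖ ^ 2 ≤ smoothedNorm ε y := by
  have h := real_inner_le_norm q y
  rw [smoothedNorm]
  split_ifs with hy
  · rw [le_div_iff₀ (by positivity)]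
    nlinarith [sq_nonneg (‖y‖ - ε * ‖q‖)]
  · nlinarith [norm_nonneg q, mul_nonneg (sub_nonneg.2 hq) (sub_nonneg.2 (not_le.1 hy).le),
      mul_nonneg hε.le (sq_nonneg (1 - ‖q‖))]

lemma smoothedNorm_add_inner_le (hε : 0 < ε) (y z : F) :
    smoothedNorm ε y + ⟪smoothedNormGradient ε y, z - y⟫ ≤ smoothedNorm ε z := by
  have h := inner_sub_le_smoothedNorm hε z (norm_smoothedNormGradient_le_one hε y)
  rw [smoothedNorm_eq hε y, inner_sub_right]
  linarith

/-- The gradient of `z ↦ ∑ i, smoothedNorm ε (z i)`, computed componentwise. -/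
noncomputable def sumSmoothedNormGradient {ι : Type*} (ε : ℝ)
    (z : PiLp 2 (fun _ : ι => F)) : PiLp 2 (fun _ : ι => F) :=
  WithLp.toLp 2 fun i => smoothedNormGradient ε (z i)

variable {ι : Type*} [Fintype ι]

lemma norm_sumSmoothedNormGradient_le (hε : 0 < ε) (z : PiLp 2 (fun _ : ι => F)) :
    ‖sumSmoothedNormGradient ε z‖ ≤ √(Fintype.card ι) := by
  rw [PiLp.norm_eq_of_L2]
  refine Real.sqrt_le_sqrt ((Finset.sum_le_card_nsmul _ _ 1 fun i _ => ?_).trans (by simp))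
  exact pow_le_one₀ (norm_nonneg _) (norm_smoothedNormGradient_le_one hε _)

lemma norm_sumSmoothedNormGradient_sub_le (hε : 0 < ε) (z w : PiLp 2 (fun _ : ι => F)) :
    ‖sumSmoothedNormGradient ε z - sumSmoothedNormGradient ε w‖ ≤ ε⁻¹ * ‖z - w‖ := by
  refine le_of_sq_le_sq ?_ (by positivity)
  rw [mul_pow, PiLp.norm_sq_eq_of_L2, PiLp.norm_sq_eq_of_L2, Finset.mul_sum]
  refine Finset.sum_le_sum fun i _ => ?_
  rw [← mul_pow]
  exact pow_le_pow_left₀ (norm_nonneg _) (norm_smoothedNormGradient_sub_le hε _ _) 2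

lemma hasFDerivAt_sum_smoothedNorm (hε : 0 < ε) (z : PiLp 2 (fun _ : ι => F)) :
    HasFDerivAt (fun z : PiLp 2 (fun _ : ι => F) => ∑ i, smoothedNorm ε (z i))
      (innerSL ℝ (sumSmoothedNormGradient ε z)) z := by
  refine hasFDerivAt_of_lipschitz_subgradient (fun u v => ?_)
    (norm_sumSmoothedNormGradient_sub_le hε) z
  rw [PiLp.inner_apply, ← Finset.sum_add_distrib]
  exact Finset.sum_le_sum fun i _ => smoothedNorm_add_inner_le hε _ _

end SmoothedNorm

/-- If `g : E → F^m` (with `F^m` carrying the `ℓ²` product structure) is `C¹` with an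
`L_g`-Lipschitz derivative bounded by `M`, then the gradient of the smoothed regularizer
`r_ε(y) = Σᵢ H_ε(gᵢ(y))` is Lipschitz with constant `√m · L_g + M²/ε`. -/
theorem gradient_smoothed_regularizer_lipschitz
    {E F : Type*} [NormedAddCommGroup E] [InnerProductSpace ℝ E] [FiniteDimensional ℝ E]
    [NormedAddCommGroup F] [InnerProductSpace ℝ F] [FiniteDimensional ℝ F]
    {m : ℕ} (g : E → PiLp 2 (fun _ : Fin m => F)) (hg : ContDiff ℝ 1 g)
    (Lg M : ℝ)
    (hLip : ∀ y y' : E, ‖fderiv ℝ g y - fderiv ℝ g y'‖ ≤ Lg * ‖y - y'‖)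
    (hM : ∀ y : E, ‖fderiv ℝ g y‖ ≤ M)
    {ε : ℝ} (hε : 0 < ε) :
    ∀ y y' : E,
      ‖gradient (fun y : E => ∑ i, smoothedNorm ε (g y i)) y -
        gradient (fun y : E => ∑ i, smoothedNorm ε (g y i)) y'‖ ≤
      (Real.sqrt m * Lg + M ^ 2 / ε) * ‖y - y'‖ := by
  intro y y'
  have hd : Differentiable ℝ g := hg.differentiable one_ne_zero
  have hM₀ : 0 ≤ M := (norm_nonneg (fderiv ℝ g y)).trans (hM y)
  have hr (x : E) : HasFDerivAt (fun y : E => ∑ i, smoothedNorm ε (g y i))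
      ((innerSL ℝ (sumSmoothedNormGradient ε (g x))).comp (fderiv ℝ g x)) x :=
    (hasFDerivAt_sum_smoothedNorm hε (g x)).comp x (hd x).hasFDerivAt
  have hgLip : ‖g y - g y'‖ ≤ M * ‖y - y'‖ :=
    convex_univ.norm_image_sub_le_of_norm_fderiv_le (fun x _ => hd x) (fun x _ => hM x)
      (Set.mem_univ _) (Set.mem_univ _)
  rw [gradient, gradient, ← map_sub, LinearIsometryEquiv.norm_map, (hr y).fderiv, (hr y').fderiv]
  set P := sumSmoothedNormGradient ε (g y)
  set P' := sumSmoothedNormGradient ε (g y')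
  have hPm : ‖P‖ ≤ √m := by
    simpa using norm_sumSmoothedNormGradient_le hε (g y)
  have hPP' : ‖P - P'‖ ≤ ε⁻¹ * (M * ‖y - y'‖) :=
    (norm_sumSmoothedNormGradient_sub_le hε _ _).trans (by gcongr)
  have h_split : (innerSL ℝ P).comp (fderiv ℝ g y) - (innerSL ℝ P').comp (fderiv ℝ g y') =
      (innerSL ℝ P).comp (fderiv ℝ g y - fderiv ℝ g y') +
        (innerSL ℝ (P - P')).comp (fderiv ℝ g y') := by
    ext x
    simp
  rw [h_split]
  calc _ ≤ ‖innerSL ℝ P‖ * ‖fderiv ℝ g y - fderiv ℝ g y'‖ +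
        ‖innerSL ℝ (P - P')‖ * ‖fderiv ℝ g y'‖ :=
        norm_add_le_of_le (ContinuousLinearMap.opNorm_comp_le _ _)
          (ContinuousLinearMap.opNorm_comp_le _ _)
    _ ≤ √m * (Lg * ‖y - y'‖) + ε⁻¹ * (M * ‖y - y'‖) * M := by
        rw [innerSL_apply_norm, innerSL_apply_norm]
        gcongr
        · exact hLip y y'
        · exact hM y'
    _ = _ := by
        field_simp
end

section
/- Let E, F be finite-dimensional real inner product spaces and f : E × F → ℝ be continuously differentiable with ∇f Lipschitz continuous with constant L > 0. Fix (x, z) ∈ E × F and step sizes a, b > 0, and define the alternating gradient step v^x = x − a∇_x f(x, z) and v^z = z − b∇_z f(v^x, z). Then f(v^x, v^z) ≤ f(x, z) + (L/2 − 1/a)‖v^x − x‖² + (L/2 − 1/b)‖v^z − z‖². -/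
/-- Descent lemma: a differentiable function whose gradient is `L`-Lipschitz relative to `x` lies
below its quadratic upper model at `x`. -/
theorem le_add_inner_gradient_add_sq {H : Type*} [NormedAddCommGroup H] [InnerProductSpace ℝ H]
    [CompleteSpace H] {g : H → ℝ} (hg : Differentiable ℝ g) {L : ℝ} {x : H}
    (hL : ∀ y, ‖gradient g y - gradient g x‖ ≤ L * ‖y - x‖) (y : H) :
    g y ≤ g x + inner ℝ (gradient g x) (y - x) + L / 2 * ‖y - x‖ ^ 2 := by
  set d := y - x with hd
  let h : ℝ → ℝ := fun t =>
    g (x + t • d) - t * inner ℝ (gradient g x) d - L / 2 * ‖d‖ ^ 2 * t ^ 2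
  have hderiv : ∀ t, HasDerivAt h
      (inner ℝ (gradient g (x + t • d) - gradient g x) d - L * t * ‖d‖ ^ 2) t := by
    intro t
    have hline : HasDerivAt (fun t : ℝ => x + t • d) d t := by
      simpa using ((hasDerivAt_id t).smul_const d).const_add x
    have hcomp : HasDerivAt (fun t : ℝ => g (x + t • d))
        (inner ℝ (gradient g (x + t • d)) d) t := by
      exact ((hg (x + t • d)).hasGradientAt.hasFDerivAt.comp_hasDerivAt t hline).congr_deriv
        (by simp)
    refine ((hcomp.sub ((hasDerivAt_id t).mul_const (inner ℝ (gradient g x) d))).sub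
      ((hasDerivAt_pow 2 t).const_mul (L / 2 * ‖d‖ ^ 2))).congr_deriv ?_
    rw [inner_sub_left]
    push_cast
    ring
  have hanti : AntitoneOn h (Set.Icc 0 1) := by
    refine antitoneOn_of_deriv_nonpos (convex_Icc 0 1)
      (fun t _ => (hderiv t).continuousAt.continuousWithinAt)
      (fun t _ => (hderiv t).differentiableAt.differentiableWithinAt) fun t ht => ?_
    rw [interior_Icc] at ht
    rw [(hderiv t).deriv, sub_nonpos]
    have hLt := hL (x + t • d)
    rw [add_sub_cancel_left, norm_smul, Real.norm_of_nonneg ht.1.le] at hLt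
    calc inner ℝ (gradient g (x + t • d) - gradient g x) d
        ≤ ‖gradient g (x + t • d) - gradient g x‖ * ‖d‖ := real_inner_le_norm _ _
      _ ≤ L * (t * ‖d‖) * ‖d‖ := by gcongr
      _ = L * t * ‖d‖ ^ 2 := by ring
  have h01 := hanti (Set.left_mem_Icc.2 zero_le_one) (Set.right_mem_Icc.2 zero_le_one) zero_le_one
  simp only [h, one_smul, zero_smul, add_zero, hd, add_sub_cancel] at h01
  rw [← hd] at h01
  linarith

/-- Descent estimate for a single gradient step with step size `a`. -/
theorem gradient_step_le {H : Type*} [NormedAddCommGroup H] [InnerProductSpace ℝ H]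
    [CompleteSpace H] {g : H → ℝ} (hg : Differentiable ℝ g) {L : ℝ} {x v : H}
    (hL : ∀ y, ‖gradient g y - gradient g x‖ ≤ L * ‖y - x‖) {a : ℝ} (ha : a ≠ 0)
    (hv : v = x - a • gradient g x) :
    g v ≤ g x + (L / 2 - 1 / a) * ‖v - x‖ ^ 2 := by
  have hinner : inner ℝ (gradient g x) (v - x) = -(1 / a) * ‖v - x‖ ^ 2 := by
    have hgrad : gradient g x = -(1 / a) • (v - x) := by
      rw [hv, sub_sub_cancel_left, smul_neg, neg_smul, neg_neg, smul_smul, one_div_mul_cancel ha,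
        one_smul]
    rw [hgrad, real_inner_smul_left, real_inner_self_eq_norm_sq]
  have := le_add_inner_gradient_add_sq hg hL v
  rw [hinner] at this
  linarith

/-- Descent estimate for one alternating (block coordinate) gradient step:
`f(vˣ, vᶻ) ≤ f(x,z) + (L/2 − 1/a)‖vˣ−x‖² + (L/2 − 1/b)‖vᶻ−z‖²`. -/
theorem alternating_gradient_step_descent
    {E F : Type*} [NormedAddCommGroup E] [InnerProductSpace ℝ E] [FiniteDimensional ℝ E]
    [NormedAddCommGroup F] [InnerProductSpace ℝ F] [FiniteDimensional ℝ F]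
    (f : E → F → ℝ) (hf : ContDiff ℝ 1 (fun p : E × F => f p.1 p.2))
    (L : ℝ) (hL : 0 < L)
    (hLip : ∀ (x x' : E) (z z' : F),
      ‖gradient (fun w => f w z) x - gradient (fun w => f w z') x'‖ ^ 2 +
        ‖gradient (fun w => f x w) z - gradient (fun w => f x' w) z'‖ ^ 2 ≤
      L ^ 2 * (‖x - x'‖ ^ 2 + ‖z - z'‖ ^ 2))
    (x : E) (z : F) (a b : ℝ) (ha : 0 < a) (hb : 0 < b)
    (vx : E) (hvx : vx = x - a • gradient (fun w => f w z) x)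
    (vz : F) (hvz : vz = z - b • gradient (fun w => f vx w) z) :
    f vx vz ≤ f x z + (L / 2 - 1 / a) * ‖vx - x‖ ^ 2 + (L / 2 - 1 / b) * ‖vz - z‖ ^ 2 := by
  have hd : Differentiable ℝ (fun p : E × F => f p.1 p.2) := hf.differentiable one_ne_zero
  have hdx : Differentiable ℝ (fun w => f w z) :=
    hd.comp (differentiable_id.prodMk (differentiable_const z))
  have hdz : Differentiable ℝ (fun w => f vx w) :=
    hd.comp ((differentiable_const vx).prodMk differentiable_id)
  have hstepx := gradient_step_le hdx (L := L) (fun y => by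
    refine (sq_le_sq₀ (norm_nonneg _) (by positivity)).1 ?_
    have := hLip y x z z
    rw [sub_self z, norm_zero] at this
    nlinarith [sq_nonneg ‖gradient (fun w => f y w) z - gradient (fun w => f x w) z‖]) ha.ne' hvx
  have hstepz := gradient_step_le hdz (L := L) (fun y => by
    refine (sq_le_sq₀ (norm_nonneg _) (by positivity)).1 ?_
    have := hLip vx vx y z
    rw [sub_self vx, norm_zero] at this
    nlinarith [sq_nonneg ‖gradient (fun w => f w y) vx - gradient (fun w => f w z) vx‖]) hb.ne' hvz
  linarith
end

section
/- Let E, F be finite-dimensional real inner product spaces and f : E × F → ℝ be continuously differentiable with ∇f Lipschitz continuous with constant L > 0, and let δ > 0. Fix (x, z) ∈ E × F and step sizes a, b with 0 < a ≤ 1/(δ + L/2) and 0 < b ≤ 1/(δ + L/2), and define v^x = x − a∇_x f(x, z) and v^z = z − b∇_z f(v^x, z). Then the sufficient descent condition holds: f(v^x, v^z) − f(x, z) ≤ −δ(‖v^x − x‖² + ‖v^z − z‖²). In particular, the backtracking line search in LAMA, which multiplies the step sizes by ρ ∈ (0,1) until this condition holds, terminates after finitely many reductions. -/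
/-- The descent lemma: a differentiable function whose gradient is `L`-Lipschitz around `x` is
bounded above by its quadratic model at `x`. -/
theorem le_quadratic_model_of_gradient_lipschitz
    {E : Type*} [NormedAddCommGroup E] [InnerProductSpace ℝ E] [CompleteSpace E]
    {g : E → ℝ} (hg : Differentiable ℝ g) {L : ℝ} {x : E}
    (hLip : ∀ y, ‖gradient g y - gradient g x‖ ≤ L * ‖y - x‖) (d : E) :
    g (x + d) ≤ g x + inner ℝ (gradient g x) d + L / 2 * ‖d‖ ^ 2 := by
  let φ : ℝ → ℝ := fun t => g (x + t • d) - t * inner ℝ (gradient g x) d - L / 2 * ‖d‖ ^ 2 * t ^ 2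
  let φ' : ℝ → ℝ := fun t =>
    inner ℝ (gradient g (x + t • d)) d - inner ℝ (gradient g x) d - L * ‖d‖ ^ 2 * t
  have hline (t : ℝ) : HasDerivAt (fun s : ℝ => x + s • d) d t := by
    simpa using ((hasDerivAt_id t).smul_const d).const_add x
  have hφ (t : ℝ) : HasDerivAt φ (φ' t) t := by
    have h₁ := (hg (x + t • d)).hasGradientAt.hasFDerivAt.comp_hasDerivAt t (hline t)
    have h₂ := (hasDerivAt_id t).mul_const (inner ℝ (gradient g x) d)
    have h₃ := (hasDerivAt_pow 2 t).const_mul (L / 2 * ‖d‖ ^ 2)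
    refine ((h₁.sub h₂).sub h₃).congr_deriv ?_
    simp only [InnerProductSpace.toDual_apply_apply, φ']
    push_cast
    ring
  have hφ'_nonpos (t : ℝ) (ht : 0 ≤ t) : φ' t ≤ 0 := by
    have hbound := hLip (x + t • d)
    rw [add_sub_cancel_left, norm_smul, Real.norm_of_nonneg ht] at hbound
    have hinner := real_inner_le_norm (gradient g (x + t • d) - gradient g x) d
    rw [inner_sub_left] at hinner
    have := mul_le_mul_of_nonneg_right hbound (norm_nonneg d)
    simp only [φ']
    linarith
  have hanti : AntitoneOn φ (Set.Icc 0 1) := by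
    refine antitoneOn_of_deriv_nonpos (convex_Icc 0 1)
      (fun t _ => (hφ t).continuousAt.continuousWithinAt)
      (fun t _ => (hφ t).differentiableAt.differentiableWithinAt) fun t ht => ?_
    rw [interior_Icc] at ht
    rw [(hφ t).deriv]
    exact hφ'_nonpos t ht.1.le
  have h := hanti (Set.left_mem_Icc.2 zero_le_one) (Set.right_mem_Icc.2 zero_le_one) zero_le_one
  simp only [φ, one_smul, zero_smul, add_zero] at h
  linarith

/-- A gradient step of size `a ≤ 1 / (δ + L / 2)` decreases the function by at least `δ` times
the squared length of the step. -/
theorem gradient_step_sufficient_descent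
    {E : Type*} [NormedAddCommGroup E] [InnerProductSpace ℝ E] [CompleteSpace E]
    {g : E → ℝ} (hg : Differentiable ℝ g) {L δ a : ℝ} {x : E}
    (hLip : ∀ y, ‖gradient g y - gradient g x‖ ≤ L * ‖y - x‖)
    (hδL : 0 < δ + L / 2) (ha : 0 ≤ a) (ha' : a ≤ 1 / (δ + L / 2)) :
    g (x - a • gradient g x) - g x ≤ -δ * ‖(x - a • gradient g x) - x‖ ^ 2 := by
  have h := le_quadratic_model_of_gradient_lipschitz hg hLip (-(a • gradient g x))
  rw [← sub_eq_add_neg, inner_neg_right, real_inner_smul_right, real_inner_self_eq_norm_sq,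
    norm_neg, norm_smul, Real.norm_of_nonneg ha] at h
  rw [sub_sub_cancel_left, norm_neg, norm_smul, Real.norm_of_nonneg ha]
  rw [le_div_iff₀ hδL] at ha'
  nlinarith [mul_nonneg (mul_nonneg ha (sq_nonneg ‖gradient g x‖)) (sub_nonneg.2 ha')]


/-- If the step sizes satisfy `0 < a, b ≤ 1/(δ + L/2)`, one alternating gradient step
satisfies the sufficient descent condition with parameter `δ`; in particular the
backtracking line search of LAMA terminates after finitely many reductions. -/
theorem alternating_gradient_step_sufficient_descent
    {E F : Type*} [NormedAddCommGroup E] [InnerProductSpace ℝ E] [FiniteDimensional ℝ E]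
    [NormedAddCommGroup F] [InnerProductSpace ℝ F] [FiniteDimensional ℝ F]
    (f : E → F → ℝ) (hf : ContDiff ℝ 1 (fun p : E × F => f p.1 p.2))
    (L : ℝ) (hL : 0 < L)
    (hLip : ∀ (x x' : E) (z z' : F),
      ‖gradient (fun w => f w z) x - gradient (fun w => f w z') x'‖ ^ 2 +
        ‖gradient (fun w => f x w) z - gradient (fun w => f x' w) z'‖ ^ 2 ≤
      L ^ 2 * (‖x - x'‖ ^ 2 + ‖z - z'‖ ^ 2))
    (δ : ℝ) (hδ : 0 < δ)
    (x : E) (z : F) (a b : ℝ) (ha : 0 < a) (hb : 0 < b)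
    (ha' : a ≤ 1 / (δ + L / 2)) (hb' : b ≤ 1 / (δ + L / 2))
    (vx : E) (hvx : vx = x - a • gradient (fun w => f w z) x)
    (vz : F) (hvz : vz = z - b • gradient (fun w => f vx w) z) :
    f vx vz - f x z ≤ -δ * (‖vx - x‖ ^ 2 + ‖vz - z‖ ^ 2) := by
  have hf' : Differentiable ℝ (fun p : E × F => f p.1 p.2) := hf.differentiable one_ne_zero
  have hfst : Differentiable ℝ (fun w => f w z) :=
    hf'.comp (differentiable_id.prodMk (differentiable_const z))
  have hsnd : Differentiable ℝ (fun w => f vx w) :=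
    hf'.comp ((differentiable_const vx).prodMk differentiable_id)
  have hLip_fst (y : E) : ‖gradient (fun w => f w z) y - gradient (fun w => f w z) x‖ ≤
      L * ‖y - x‖ := by
    refine (abs_le_of_sq_le_sq' ?_ (by positivity)).2
    have h := hLip y x z z
    rw [sub_self z, norm_zero] at h
    nlinarith [sq_nonneg ‖gradient (fun w => f y w) z - gradient (fun w => f x w) z‖]
  have hLip_snd (y : F) : ‖gradient (fun w => f vx w) y - gradient (fun w => f vx w) z‖ ≤
      L * ‖y - z‖ := by
    refine (abs_le_of_sq_le_sq' ?_ (by positivity)).2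
    have h := hLip vx vx y z
    rw [sub_self vx, norm_zero] at h
    nlinarith [sq_nonneg ‖gradient (fun w => f w y) vx - gradient (fun w => f w z) vx‖]
  have hδL : 0 < δ + L / 2 := by positivity
  have hx := gradient_step_sufficient_descent hfst hLip_fst hδL ha.le ha'
  have hz := gradient_step_sufficient_descent hsnd hLip_snd hδL hb.le hb'
  rw [← hvx] at hx
  rw [← hvz] at hz
  linarith
end

section
/- Let E, F be finite-dimensional real inner product spaces, f : E × F → ℝ continuously differentiable with ∇f Lipschitz continuous with constant L > 0, δ > 0, and τ ∈ (0,1]. Fix (x, z) ∈ E × F and step sizes a, b with a ≥ τ/L and b ≥ τ/L, define v^x = x − a∇_x f(x, z) and v^z = z − b∇_z f(v^x, z), and assume the sufficient descent condition f(v^x, v^z) − f(x, z) ≤ −δ(‖v^x − x‖² + ‖v^z − z‖²) holds. Then there exists a constant C > 0, depending only on δ and τ (not on f, L, x, z, a, b), such that ‖∇_x f(x, z)‖² + ‖∇_z f(x, z)‖² ≤ C L² (f(x, z) − f(v^x, v^z)). -/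
universe u v

/-- A gradient step of size `a ≥ τ/L` controls the length of its direction. -/
theorem sq_mul_norm_sq_le_of_step {V : Type*} [NormedAddCommGroup V] [NormedSpace ℝ V]
    {τ L a : ℝ} (hτ : 0 < τ) (hL : 0 < L) (ha : τ / L ≤ a) {x v g : V}
    (hv : v = x - a • g) : τ ^ 2 * ‖g‖ ^ 2 ≤ L ^ 2 * ‖v - x‖ ^ 2 := by
  have ha0 : 0 < a := (div_pos hτ hL).trans_le ha
  have hn : ‖v - x‖ = a * ‖g‖ := by
    rw [hv, sub_sub_cancel_left, norm_neg, norm_smul, Real.norm_of_nonneg ha0.le]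
  have hle : τ ≤ L * a := by rwa [div_le_iff₀' hL] at ha
  rw [hn, ← mul_pow, ← mul_pow, ← mul_assoc]
  gcongr

theorem norm_sq_le_two_mul_norm_sq_add {V : Type*} [NormedAddCommGroup V]
    (u w : V) : ‖u‖ ^ 2 ≤ 2 * ‖w‖ ^ 2 + 2 * ‖u - w‖ ^ 2 := by
  have h : ‖u‖ ≤ ‖w‖ + ‖u - w‖ := norm_le_norm_add_norm_sub' u w
  nlinarith [norm_nonneg u, sq_nonneg (‖w‖ - ‖u - w‖)]

/-- There is a constant `C > 0`, depending only on `δ` and `τ`, such that whenever one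
alternating gradient step with step sizes `a, b ≥ τ/L` satisfies the sufficient descent
condition, the squared gradient at the current point is bounded by
`C L² (f(x,z) − f(vˣ,vᶻ))`. -/
theorem gradient_bound_from_sufficient_descent
    (δ τ : ℝ) (hδ : 0 < δ) (hτ0 : 0 < τ) (hτ1 : τ ≤ 1) :
    ∃ C : ℝ, 0 < C ∧
      ∀ (E : Type u) (F : Type v)
        [NormedAddCommGroup E] [InnerProductSpace ℝ E] [FiniteDimensional ℝ E]
        [NormedAddCommGroup F] [InnerProductSpace ℝ F] [FiniteDimensional ℝ F]
        (f : E → F → ℝ), ContDiff ℝ 1 (fun p : E × F => f p.1 p.2) →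
        ∀ (L : ℝ), 0 < L →
        (∀ (x x' : E) (z z' : F),
          ‖gradient (fun w => f w z) x - gradient (fun w => f w z') x'‖ ^ 2 +
            ‖gradient (fun w => f x w) z - gradient (fun w => f x' w) z'‖ ^ 2 ≤
          L ^ 2 * (‖x - x'‖ ^ 2 + ‖z - z'‖ ^ 2)) →
        ∀ (x : E) (z : F) (a b : ℝ), τ / L ≤ a → τ / L ≤ b →
        ∀ (vx : E) (vz : F),
          vx = x - a • gradient (fun w => f w z) x →
          vz = z - b • gradient (fun w => f vx w) z →
          f vx vz - f x z ≤ -δ * (‖vx - x‖ ^ 2 + ‖vz - z‖ ^ 2) →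
          ‖gradient (fun w => f w z) x‖ ^ 2 + ‖gradient (fun w => f x w) z‖ ^ 2 ≤
            C * L ^ 2 * (f x z - f vx vz) := by
  refine ⟨4 / (τ ^ 2 * δ), by positivity, ?_⟩
  intro E F _ _ _ _ _ _ f _ L hL hLip x z a b ha hb vx vz hvx hvz hdesc
  have hg := sq_mul_norm_sq_le_of_step hτ0 hL ha hvx
  have hh := sq_mul_norm_sq_le_of_step hτ0 hL hb hvz
  have hl := hLip x vx z z
  have hk := norm_sq_le_two_mul_norm_sq_add
    (gradient (fun w => f x w) z) (gradient (fun w => f vx w) z)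
  rw [sub_self z, norm_zero, norm_sub_rev x vx] at hl
  generalize gradient (fun w => f w z) x = g at *
  generalize gradient (fun w => f x w) z = k at *
  generalize gradient (fun w => f vx w) z = h at *
  have hkh : ‖k - h‖ ^ 2 ≤ L ^ 2 * ‖vx - x‖ ^ 2 := by
    nlinarith [sq_nonneg ‖g - gradient (fun w => f w z) vx‖]
  have hτ : τ ^ 2 ≤ 1 := pow_le_one₀ hτ0.le hτ1
  have hkh' : τ ^ 2 * ‖k - h‖ ^ 2 ≤ L ^ 2 * ‖vx - x‖ ^ 2 :=
    (mul_le_of_le_one_left (by positivity) hτ).trans hkh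
  have hk' := mul_le_mul_of_nonneg_left hk (sq_nonneg τ)
  have hsum : τ ^ 2 * (‖g‖ ^ 2 + ‖k‖ ^ 2) ≤
      4 * L ^ 2 * (‖vx - x‖ ^ 2 + ‖vz - z‖ ^ 2) := by
    have h1 : 0 ≤ L ^ 2 * ‖vx - x‖ ^ 2 := by positivity
    have h2 : 0 ≤ L ^ 2 * ‖vz - z‖ ^ 2 := by positivity
    linarith
  have hd : δ * (‖vx - x‖ ^ 2 + ‖vz - z‖ ^ 2) ≤ f x z - f vx vz := by linarith
  rw [div_mul_eq_mul_div, div_mul_eq_mul_div, le_div_iff₀ (by positivity)]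
  calc (‖g‖ ^ 2 + ‖k‖ ^ 2) * (τ ^ 2 * δ) = δ * (τ ^ 2 * (‖g‖ ^ 2 + ‖k‖ ^ 2)) := by ring
    _ ≤ δ * (4 * L ^ 2 * (‖vx - x‖ ^ 2 + ‖vz - z‖ ^ 2)) := by gcongr
    _ = 4 * L ^ 2 * (δ * (‖vx - x‖ ^ 2 + ‖vz - z‖ ^ 2)) := by ring
    _ ≤ 4 * L ^ 2 * (f x z - f vx vz) := by gcongr
end

section
/- Let E, F be finite-dimensional real inner product spaces, g : E → F^m continuously differentiable with components g_i, and r(y) = Σ_{i=1}^m ‖g_i(y)‖. Then r is locally Lipschitz, and its Clarke generalized directional derivative at any y ∈ E in any direction v ∈ E is r°(y; v) = Σ_{i : g_i(y) ≠ 0} ⟨g_i(y)/‖g_i(y)‖, Dg_i(y)v⟩ + Σ_{i : g_i(y) = 0} ‖Dg_i(y)v‖. -/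
open scoped RealInnerProductSpace

/-- The Clarke generalized directional derivative
`f°(x; v) = limsup_{c → x, t ↓ 0} (f(c + t v) − f(c))/t`. -/
noncomputable def clarkeDeriv {E : Type*} [NormedAddCommGroup E] [NormedSpace ℝ E]
    (f : E → ℝ) (x v : E) : ℝ :=
  Filter.limsup (fun p : E × ℝ => (f (p.1 + p.2 • v) - f p.1) / p.2)
    ((nhds x) ×ˢ (nhdsWithin 0 (Set.Ioi 0)))

open Filter Topology in
/-- Along a filter finer than `l` the function agrees with a convergent majorant, so the majorant
is sharp for the upper limit. -/
theorem limsup_eq_of_eventuallyLE_of_tendsto {α : Type*} {l l' : Filter α} [l'.NeBot]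
    {u w : α → ℝ} {a : ℝ} (hl : l' ≤ l) (hle : u ≤ᶠ[l] w) (heq : u =ᶠ[l'] w)
    (hw : Tendsto w l (𝓝 a)) : limsup u l = a := by
  have : l.NeBot := NeBot.mono ‹_› hl
  have hu' : Tendsto u l' (𝓝 a) := (hw.mono_left hl).congr' heq.symm
  have hbdd : l.IsBoundedUnder (· ≤ ·) u := hw.isBoundedUnder_le.mono_le hle
  have hcobdd : l.IsCoboundedUnder (· ≤ ·) u :=
    hu'.isCoboundedUnder_le.mono (map_mono hl)
  apply le_antisymm
  · exact (limsup_le_limsup hle hcobdd hw.isBoundedUnder_le).trans_eq hw.limsup_eq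
  · rw [← hu'.limsup_eq]
    exact limsup_le_limsup_of_le hl hu'.isCoboundedUnder_le hbdd

open Filter Topology in
/-- At a point of strict differentiability, difference quotients with moving base point converge
to the derivative. -/
theorem HasStrictFDerivAt.tendsto_smul_sub {E F : Type*} [NormedAddCommGroup E] [NormedSpace ℝ E]
    [NormedAddCommGroup F] [NormedSpace ℝ F] {f : E → F} {f' : E →L[ℝ] F} {y : E}
    (hf : HasStrictFDerivAt f f' y) (v : E) :
    Tendsto (fun p : E × ℝ => p.2⁻¹ • (f (p.1 + p.2 • v) - f p.1)) (𝓝 y ×ˢ 𝓝[>] 0)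
      (𝓝 (f' v)) := by
  have hfst : Tendsto (fun p : E × ℝ => p.1) (𝓝 y ×ˢ 𝓝[>] 0) (𝓝 y) := tendsto_fst
  have hsnd : Tendsto (fun p : E × ℝ => p.2) (𝓝 y ×ˢ 𝓝[>] 0) (𝓝 0) :=
    tendsto_snd.mono_right nhdsWithin_le_nhds
  have hpos : ∀ᶠ p : E × ℝ in 𝓝 y ×ˢ 𝓝[>] 0, 0 < p.2 :=
    tendsto_snd.eventually self_mem_nhdsWithin
  have hpair : Tendsto (fun p : E × ℝ => (p.1 + p.2 • v, p.1)) (𝓝 y ×ˢ 𝓝[>] 0) (𝓝 (y, y)) := by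
    refine Tendsto.prodMk_nhds ?_ hfst
    simpa using hfst.add (hsnd.smul_const v)
  have ho := hf.isLittleO.comp_tendsto hpair
  have hO : (fun p : E × ℝ => p.2 • v) =O[𝓝 y ×ˢ 𝓝[>] 0] fun p => p.2 :=
    .of_bound ‖v‖ (.of_forall fun p => by rw [norm_smul, mul_comm])
  have ho' : (fun p : E × ℝ => f (p.1 + p.2 • v) - f p.1 - p.2 • f' v)
      =o[𝓝 y ×ˢ 𝓝[>] 0] fun p => p.2 := by
    refine .trans_isBigO (by simpa [Function.comp_def] using ho) hO
  rw [← tendsto_sub_nhds_zero_iff]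
  refine ho'.tendsto_inv_smul_nhds_zero.congr' ?_
  · filter_upwards [hpos] with p hp
    rw [smul_sub, inv_smul_smul₀ hp.ne']

/-- The norm of a function strictly differentiable at a point where it does not vanish. -/
theorem HasStrictFDerivAt.norm_of_ne_zero {E F : Type*} [NormedAddCommGroup E] [NormedSpace ℝ E]
    [NormedAddCommGroup F] [InnerProductSpace ℝ F] {f : E → F} {f' : E →L[ℝ] F} {y : E}
    (hf : HasStrictFDerivAt f f' y) (h0 : f y ≠ 0) :
    HasStrictFDerivAt (fun x => ‖f x‖) ((innerSL ℝ (‖f y‖⁻¹ • f y)).comp f') y := by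
  have h := ((hasStrictFDerivAt_norm_sq (f y)).comp y hf).sqrt (by simpa using h0)
  simp only [Real.sqrt_sq (norm_nonneg _)] at h
  refine h.congr_fderiv ?_
  ext v
  simp
  field_simp

open Classical in
/-- The (2,1)-norm regularizer `r(y) = Σᵢ ‖gᵢ(y)‖` is locally Lipschitz and its Clarke
directional derivative is
`r°(y; v) = Σ_{gᵢ(y) ≠ 0} ⟪gᵢ(y)/‖gᵢ(y)‖, Dgᵢ(y)v⟫ + Σ_{gᵢ(y) = 0} ‖Dgᵢ(y)v‖`. -/
theorem clarkeDeriv_sum_norm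
    {E F : Type*} [NormedAddCommGroup E] [InnerProductSpace ℝ E] [FiniteDimensional ℝ E]
    [NormedAddCommGroup F] [InnerProductSpace ℝ F] [FiniteDimensional ℝ F]
    {m : ℕ} (g : Fin m → E → F) (hg : ∀ i, ContDiff ℝ 1 (g i)) :
    LocallyLipschitz (fun y : E => ∑ i, ‖g i y‖) ∧
    ∀ (y v : E),
      clarkeDeriv (fun y : E => ∑ i, ‖g i y‖) y v =
        ∑ i, (if g i y = 0 then ‖fderiv ℝ (g i) y v‖
              else ⟪‖g i y‖⁻¹ • g i y, fderiv ℝ (g i) y v⟫) := by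
  open Filter Topology in
  refine ⟨?_, fun y v => ?_⟩
  · have hlip : LipschitzWith (m : NNReal) (fun x : Fin m → F => ∑ i, ‖x i‖) := by
      refine LipschitzWith.of_dist_le_mul fun x z => ?_
      rw [Real.dist_eq, ← Finset.sum_sub_distrib]
      calc |∑ i, (‖x i‖ - ‖z i‖)| ≤ ∑ i, |‖x i‖ - ‖z i‖| := Finset.abs_sum_le_sum_abs _ _
        _ ≤ ∑ _i : Fin m, dist x z := Finset.sum_le_sum fun i _ =>
            (abs_norm_sub_norm_le _ _).trans (by rw [← dist_eq_norm]; exact dist_le_pi_dist x z i)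
        _ = (m : NNReal) * dist x z := by simp
    exact hlip.locallyLipschitz.comp (contDiff_pi.2 hg).locallyLipschitz
  have hs : ∀ i, HasStrictFDerivAt (g i) (fderiv ℝ (g i) y) y := fun i =>
    (hg i).contDiffAt.hasStrictFDerivAt one_ne_zero
  have hpos : ∀ᶠ p : E × ℝ in 𝓝 y ×ˢ 𝓝[>] 0, 0 < p.2 :=
    tendsto_snd.eventually self_mem_nhdsWithin
  let w : E × ℝ → ℝ := fun p => ∑ i, if g i y = 0
    then ‖p.2⁻¹ • (g i (p.1 + p.2 • v) - g i p.1)‖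
    else p.2⁻¹ • (‖g i (p.1 + p.2 • v)‖ - ‖g i p.1‖)
  have hfin : pure y ×ˢ 𝓝[>] (0 : ℝ) ≤ 𝓝 y ×ˢ 𝓝[>] 0 := prod_mono_left _ (pure_le_nhds y)
  refine limsup_eq_of_eventuallyLE_of_tendsto (w := w) hfin ?_ ?_ ?_
  · filter_upwards [hpos] with p hp
    rw [div_eq_inv_mul, ← Finset.sum_sub_distrib, Finset.mul_sum]
    refine Finset.sum_le_sum fun i _ => ?_
    split_ifs
    · rw [norm_smul, Real.norm_of_nonneg (inv_nonneg.2 hp.le)]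
      exact mul_le_mul_of_nonneg_left (norm_sub_norm_le _ _) (inv_nonneg.2 hp.le)
    · rfl
  · have hy : ∀ᶠ p : E × ℝ in pure y ×ˢ 𝓝[>] 0, p.1 = y :=
      tendsto_fst.eventually (p := (· = y)) (eventually_pure.2 rfl)
    filter_upwards [hfin hpos, hy] with p hp hpy
    rw [div_eq_inv_mul, ← Finset.sum_sub_distrib, Finset.mul_sum]
    refine Finset.sum_congr rfl fun i _ => ?_
    split_ifs with h
    · rw [hpy, h, norm_smul, Real.norm_of_nonneg (inv_nonneg.2 (le_of_lt hp))]
      simp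
    · rfl
  · refine tendsto_finsetSum _ fun i _ => ?_
    split_ifs with h
    · exact ((hs i).tendsto_smul_sub v).norm
    · exact ((hs i).norm_of_ne_zero h).tendsto_smul_sub v
end
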